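/- Let A be a unital simple C*-algebra with T(A) ≠ ∅ and let e ∈ A be a positive element. Assume that for every ε > 0 there exists a sequence (b_n) of mutually orthogonal positive contractions in Her(e) such that ∑_{n=1}^∞ ω(b_n) < ε and d_τ(e) − ∑_{n=1}^∞ d_τ(b_n) < ε for every τ ∈ T(A). Then e has tracial approximate oscillation zero. -/

import Mathlib

open scoped ComplexOrder

/-- A tracial state on a C*-algebra: a positive linear functional of norm one which is
tracial (`τ(xy) = τ(yx)`). -/
def IsTracialState {A : Type*} [NonUnitalNormedRing A] [StarRing A] [NormedSpace ℂ A]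
    (τ : A →L[ℂ] ℂ) : Prop :=
  (∀ x : A, 0 ≤ τ (star x * x)) ∧ ‖τ‖ = 1 ∧ ∀ x y : A, τ (x * y) = τ (y * x)

/-- The set `T(A)` of tracial states of `A`. -/
def traceSet (A : Type*) [CStarAlgebra A] : Set (A →L[ℂ] ℂ) := {τ | IsTracialState τ}

/-- The function `f_ε : ℝ → [0,1]`: `0` on `(-∞, ε]`, `1` on `[2ε, ∞)`, linear on `[ε, 2ε]`. -/
noncomputable def fE (ε : ℝ) : ℝ → ℝ := fun t => min 1 (max 0 ((t - ε) / ε))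

variable {A : Type*} [CStarAlgebra A]

/-- `d_τ(a) := sup_n τ(f_{1/n}(a))`. -/
noncomputable def dTau (τ : A →L[ℂ] ℂ) (a : A) : ℝ :=
  ⨆ n : ℕ, (τ (cfc (fE (1 / (n + 1 : ℝ))) a)).re

/-- The tracial oscillation `ω(a) = lim_n sup_{τ ∈ T(A)} (d_τ(a) − τ(f_{1/n}(a)))`; since the
sequence of suprema is nonincreasing, the limit is the infimum. -/
noncomputable def osc (a : A) : ℝ :=
  ⨅ n : ℕ, ⨆ τ : ↥(traceSet A),
    (dTau (τ : A →L[ℂ] ℂ) a - ((τ : A →L[ℂ] ℂ) (cfc (fE (1 / (n + 1 : ℝ))) a)).re)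

/-- The tracial 2-seminorm `‖x‖₂ = sup_{τ ∈ T(A)} τ(x*x)^{1/2}`. -/
noncomputable def norm2 (x : A) : ℝ :=
  ⨆ τ : ↥(traceSet A), Real.sqrt (((τ : A →L[ℂ] ℂ) (star x * x)).re)

/-- The hereditary C*-subalgebra generated by `a`, i.e. the norm closure of `aAa`. -/
def her (a : A) : Set A := closure {y : A | ∃ x : A, y = a * x * a}

/-- An element `a` has tracial approximate oscillation zero if for every `ε > 0` there is a
positive `c ∈ Her(a)` with `‖c‖ ≤ ‖a‖`, `‖a − c‖₂ < ε` and `ω(c) < ε`. -/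
def TAOZero [PartialOrder A] [StarOrderedRing A] (a : A) : Prop :=
  ∀ ε > 0, ∃ c ∈ her a, 0 ≤ c ∧ ‖c‖ ≤ ‖a‖ ∧ norm2 (a - c) < ε ∧ osc c < ε

/-- The positive tracial functionals of norm at most one. -/
def IsTracialContraction (τ : A →L[ℂ] ℂ) : Prop :=
  (∀ x : A, 0 ≤ τ (star x * x)) ∧ ‖τ‖ ≤ 1 ∧ ∀ x y : A, τ (x * y) = τ (y * x)

lemma IsTracialState.isTracialContraction {τ : A →L[ℂ] ℂ} (h : IsTracialState τ) :
    IsTracialContraction τ := ⟨h.1, h.2.1.le, h.2.2⟩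

lemma fE_nonneg (ε t : ℝ) : 0 ≤ fE ε t := le_min zero_le_one (le_max_left _ _)

lemma fE_le_one (ε t : ℝ) : fE ε t ≤ 1 := min_le_left _ _

lemma fE_eq_zero {ε t : ℝ} (hε : 0 < ε) (ht : t ≤ ε) : fE ε t = 0 := by
  have : (t - ε) / ε ≤ 0 := div_nonpos_of_nonpos_of_nonneg (by linarith) hε.le
  simp [fE, max_eq_left this]

lemma fE_eq_one {ε t : ℝ} (hε : 0 < ε) (ht : 2 * ε ≤ t) : fE ε t = 1 := by
  have : 1 ≤ (t - ε) / ε := by rw [le_div_iff₀ hε]; linarith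
  exact min_eq_left (this.trans (le_max_right _ _))

lemma continuous_fE (ε : ℝ) : Continuous (fE ε) := by
  unfold fE
  fun_prop

namespace IsTracialContraction

variable {τ : A →L[ℂ] ℂ}

lemma re_le_norm (h : IsTracialContraction τ) (x : A) : (τ x).re ≤ ‖x‖ :=
  (Complex.re_le_norm _).trans <| (τ.le_opNorm x).trans <|
    mul_le_of_le_one_left (norm_nonneg x) h.2.1

lemma re_star_mul_self_nonneg (h : IsTracialContraction τ) (x : A) :
    0 ≤ (τ (star x * x)).re := (Complex.nonneg_iff.mp (h.1 x)).1

lemma re_algebraMap_le (h : IsTracialContraction τ) {r : ℝ} (hr : 0 ≤ r) :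
    (τ (algebraMap ℝ A r)).re ≤ r := by
  cases subsingleton_or_nontrivial A
  · simpa [Subsingleton.elim (algebraMap ℝ A r) 0] using hr
  · simpa [norm_algebraMap', abs_of_nonneg hr] using h.re_le_norm (algebraMap ℝ A r)

variable [PartialOrder A] [StarOrderedRing A]

lemma re_mul_nonneg (h : IsTracialContraction τ) {x y : A} (hx : 0 ≤ x) (hy : 0 ≤ y) :
    0 ≤ (τ (x * y)).re := by
  obtain ⟨p, rfl⟩ := CStarAlgebra.nonneg_iff_eq_star_mul_self.mp hx
  obtain ⟨q, rfl⟩ := CStarAlgebra.nonneg_iff_eq_star_mul_self.mp hy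
  have := h.re_star_mul_self_nonneg (p * star q)
  rw [star_mul, star_star, mul_assoc, h.2.2 q] at this
  simpa only [mul_assoc] using this

lemma re_nonneg (h : IsTracialContraction τ) {x : A} (hx : 0 ≤ x) : 0 ≤ (τ x).re := by
  simpa using h.re_mul_nonneg hx zero_le_one

lemma re_mul_le_mul_right (h : IsTracialContraction τ) {x y z : A} (hxy : x ≤ y) (hz : 0 ≤ z) :
    (τ (x * z)).re ≤ (τ (y * z)).re := by
  simpa [sub_mul] using h.re_mul_nonneg (sub_nonneg.mpr hxy) hz

lemma re_mul_le_mul_left (h : IsTracialContraction τ) {x y z : A} (hxy : x ≤ y) (hz : 0 ≤ z) :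
    (τ (z * x)).re ≤ (τ (z * y)).re := by
  rw [h.2.2 z, h.2.2 z]
  exact h.re_mul_le_mul_right hxy hz

end IsTracialContraction

section dTau

variable {τ : A →L[ℂ] ℂ}

lemma norm_cfc_fE_le (ε : ℝ) (a : A) : ‖cfc (fE ε) a‖ ≤ 1 :=
  norm_cfc_le zero_le_one fun t _ ↦ by
    rw [Real.norm_of_nonneg (fE_nonneg ε t)]; exact fE_le_one ε t

lemma bddAbove_range_re_cfc_fE (h : IsTracialContraction τ) (a : A) :
    BddAbove (Set.range fun n : ℕ ↦ (τ (cfc (fE (1 / (n + 1 : ℝ))) a)).re) :=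
  ⟨1, by rintro _ ⟨n, rfl⟩; exact (h.re_le_norm _).trans (norm_cfc_fE_le _ a)⟩

lemma re_cfc_fE_le_dTau (h : IsTracialContraction τ) (a : A) (n : ℕ) :
    (τ (cfc (fE (1 / (n + 1 : ℝ))) a)).re ≤ dTau τ a :=
  le_ciSup (bddAbove_range_re_cfc_fE h a) n

lemma dTau_le_one (h : IsTracialContraction τ) (a : A) : dTau τ a ≤ 1 :=
  ciSup_le fun _ ↦ (h.re_le_norm _).trans (norm_cfc_fE_le _ a)

lemma neg_one_le_re_cfc_fE (h : IsTracialContraction τ) (ε : ℝ) (a : A) :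
    -1 ≤ (τ (cfc (fE ε) a)).re := by
  have := h.re_le_norm (-cfc (fE ε) a)
  rw [norm_neg, map_neg, Complex.neg_re] at this
  linarith [norm_cfc_fE_le ε a]

lemma bddAbove_range_dTau_sub (a : A) (n : ℕ) :
    BddAbove (Set.range fun τ : traceSet A ↦
      dTau (τ : A →L[ℂ] ℂ) a - ((τ : A →L[ℂ] ℂ) (cfc (fE (1 / (n + 1 : ℝ))) a)).re) := by
  refine ⟨2, ?_⟩
  rintro _ ⟨τ, rfl⟩
  have h : IsTracialContraction τ.1 := IsTracialState.isTracialContraction τ.2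
  linarith [dTau_le_one h a, neg_one_le_re_cfc_fE h (1 / (n + 1 : ℝ)) a]

lemma iSup_dTau_sub_nonneg (a : A) (n : ℕ) :
    0 ≤ ⨆ τ : traceSet A,
      (dTau (τ : A →L[ℂ] ℂ) a - ((τ : A →L[ℂ] ℂ) (cfc (fE (1 / (n + 1 : ℝ))) a)).re) :=
  Real.iSup_nonneg fun τ ↦
    sub_nonneg.mpr (re_cfc_fE_le_dTau (IsTracialState.isTracialContraction τ.2) a n)

lemma osc_nonneg (a : A) : 0 ≤ osc a := Real.iInf_nonneg (iSup_dTau_sub_nonneg a)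

lemma osc_le_of_forall {a : A} {r : ℝ} (n : ℕ) (hr : 0 ≤ r)
    (h : ∀ τ : A →L[ℂ] ℂ, IsTracialState τ →
      dTau τ a - (τ (cfc (fE (1 / (n + 1 : ℝ))) a)).re ≤ r) : osc a ≤ r :=
  (ciInf_le ⟨0, by rintro _ ⟨k, rfl⟩; exact iSup_dTau_sub_nonneg a k⟩ n).trans
    (Real.iSup_le (fun τ ↦ h τ.1 τ.2) hr)

lemma exists_dTau_sub_lt {a : A} {r : ℝ} (hr : osc a < r) :
    ∃ n : ℕ, ∀ τ : A →L[ℂ] ℂ, IsTracialState τ →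
      dTau τ a - (τ (cfc (fE (1 / (n + 1 : ℝ))) a)).re < r := by
  obtain ⟨n, hn⟩ := exists_lt_of_ciInf_lt hr
  exact ⟨n, fun τ hτ ↦ (le_ciSup (bddAbove_range_dTau_sub a n) ⟨τ, hτ⟩).trans_lt hn⟩

end dTau

section her

lemma mul_mul_mem_her {e x y : A} (hx : x ∈ her e) (hy : y ∈ her e) (z : A) :
    x * z * y ∈ her e := by
  refine map_mem_closure₂ (f := fun x y ↦ x * z * y) (by fun_prop) hx hy ?_
  rintro _ ⟨p, rfl⟩ _ ⟨q, rfl⟩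
  exact ⟨p * e * z * e * q, by noncomm_ring⟩

lemma add_mem_her {e x y : A} (hx : x ∈ her e) (hy : y ∈ her e) : x + y ∈ her e := by
  refine map_mem_closure₂ continuous_add hx hy ?_
  rintro _ ⟨p, rfl⟩ _ ⟨q, rfl⟩
  exact ⟨p + q, by noncomm_ring⟩

lemma zero_mem_her (e : A) : (0 : A) ∈ her e := subset_closure ⟨0, by simp⟩

lemma sum_mem_her {e : A} {ι : Type*} (s : Finset ι) {x : ι → A} (h : ∀ i ∈ s, x i ∈ her e) :
    ∑ i ∈ s, x i ∈ her e :=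
  Finset.sum_induction x (· ∈ her e) (fun _ _ ↦ add_mem_her) (zero_mem_her e) h

end her

/-- Continuous functional calculus of a function vanishing below a positive threshold factors
through multiplication by the element on both sides. -/
lemma exists_cfc_eq_mul_mul {φ : ℝ → ℝ} {ε : ℝ} (hε : 0 < ε) (hφ : Continuous φ)
    (h0 : ∀ t ≤ ε, φ t = 0) {b : A} (hb : IsSelfAdjoint b) :
    ∃ z : A, cfc φ b = b * z * b := by
  have hq : Continuous fun t ↦ φ t / max t ε ^ 2 :=
    hφ.div (by fun_prop) fun t ↦ (pow_pos (hε.trans_le (le_max_right t ε)) 2).ne'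
  refine ⟨cfc (fun t ↦ φ t / max t ε ^ 2) b, ?_⟩
  calc cfc φ b = cfc (fun t ↦ t * (φ t / max t ε ^ 2) * t) b := by
        refine cfc_congr fun t _ ↦ ?_
        rcases le_total t ε with ht | ht
        · simp [h0 t ht]
        · have := hε.trans_le ht
          simp only [max_eq_left ht]
          field_simp
    _ = _ := by
        rw [cfc_mul (fun t ↦ t * (φ t / max t ε ^ 2)) (fun t ↦ t) b
            (continuous_id.mul hq).continuousOn continuousOn_id,
          cfc_mul (fun t ↦ t) (fun t ↦ φ t / max t ε ^ 2) b
            continuousOn_id hq.continuousOn,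
          cfc_id' ℝ b]

lemma exists_re_lt_of_isTracialContraction {y : ℕ → A} {r : ℝ} (hr : 0 < r)
    (h : ∀ τ : A →L[ℂ] ℂ, IsTracialState τ → ∃ n, (τ (y n)).re < r)
    {τ : A →L[ℂ] ℂ} (hτ : IsTracialContraction τ) : ∃ n, (τ (y n)).re < r := by
  rcases eq_or_ne τ 0 with rfl | h0
  · exact ⟨0, by simpa using hr⟩
  have hpos : 0 < ‖τ‖ := norm_pos_iff.mpr h0
  have hσ : IsTracialState (((‖τ‖⁻¹ : ℝ) : ℂ) • τ) := by
    refine ⟨fun x ↦ ?_, ?_, fun x y ↦ ?_⟩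
    · exact mul_nonneg (Complex.zero_le_real.mpr (inv_nonneg.mpr hpos.le)) (hτ.1 x)
    · rw [norm_smul, Complex.norm_real, norm_inv, norm_norm, inv_mul_cancel₀ hpos.ne']
    · simp only [smul_apply, hτ.2.2 x y]
  obtain ⟨n, hn⟩ := h _ hσ
  refine ⟨n, ?_⟩
  rw [smul_apply, smul_eq_mul, Complex.re_ofReal_mul, inv_mul_lt_iff₀ hpos] at hn
  exact hn.trans_le (mul_le_of_le_one_left hr.le hτ.2.1)

/-- A Dini-type argument: pointwise smallness of a decreasing sequence at every tracial state
is uniform over the tracial states. -/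
lemma exists_forall_re_lt {y : ℕ → A} {r : ℝ} (hr : 0 < r)
    (hy : ∀ τ : A →L[ℂ] ℂ, IsTracialContraction τ → Antitone fun n ↦ (τ (y n)).re)
    (h : ∀ τ : A →L[ℂ] ℂ, IsTracialState τ → ∃ n, (τ (y n)).re < r) :
    ∃ n, ∀ τ : A →L[ℂ] ℂ, IsTracialState τ → (τ (y n)).re < r := by
  let K : Set (WeakDual ℂ A) := {τ | IsTracialContraction (WeakDual.toStrongDual τ)}
  have hK : IsCompact K := by
    have : K = WeakDual.toStrongDual ⁻¹' Metric.closedBall 0 1 ∩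
        ((⋂ x, {τ | 0 ≤ τ (star x * x)}) ∩ ⋂ x, ⋂ y, {τ | τ (x * y) = τ (y * x)}) := by
      ext τ
      simp only [K, IsTracialContraction, Set.mem_ofPred_eq, Set.mem_inter_iff, Set.mem_preimage,
        mem_closedBall_zero_iff, Set.mem_iInter]
      exact and_left_comm
    rw [this]
    refine (WeakDual.isCompact_closedBall _ _).inter_right <|
      (isClosed_iInter fun x ↦ ?_).inter (isClosed_iInter fun x ↦ isClosed_iInter fun y ↦ ?_)
    · exact isClosed_le continuous_const (WeakDual.eval_continuous _)
    · exact isClosed_eq (WeakDual.eval_continuous _) (WeakDual.eval_continuous _)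
  by_contra! hcon
  have hclosed (n : ℕ) : IsClosed {τ : WeakDual ℂ A | r ≤ (τ (y n)).re} :=
    isClosed_le continuous_const (Complex.continuous_re.comp (WeakDual.eval_continuous _))
  obtain ⟨τ, hτ⟩ := IsCompact.nonempty_iInter_of_sequence_nonempty_isCompact_isClosed
    (fun n ↦ K ∩ {τ : WeakDual ℂ A | r ≤ (τ (y n)).re})
    (fun n τ hτ ↦ ⟨hτ.1, hτ.2.trans (hy _ hτ.1 n.le_succ)⟩)
    (fun n ↦ by
      obtain ⟨τ, hτ, hn⟩ := hcon n
      exact ⟨StrongDual.toWeakDual τ, hτ.isTracialContraction, hn⟩)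
    (hK.inter_right (hclosed 0))
    (fun n ↦ hK.isClosed.inter (hclosed n))
  rw [Set.mem_iInter] at hτ
  obtain ⟨n, hn⟩ := exists_re_lt_of_isTracialContraction hr h (hτ 0).1
  exact hn.not_ge (hτ n).2

section StarOrdered

variable [PartialOrder A] [StarOrderedRing A]

lemma cfc_fE_nonneg (ε : ℝ) (a : A) : 0 ≤ cfc (fE ε) a := cfc_nonneg fun t _ ↦ fE_nonneg ε t

lemma cfc_fE_le_one (ε : ℝ) (a : A) : cfc (fE ε) a ≤ 1 := cfc_le_one _ _ fun t _ ↦ fE_le_one ε t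

lemma norm_cfc_fE_mul_self_sub_le {ε : ℝ} (hε : 0 < ε) {e : A} (he : 0 ≤ e) :
    ‖cfc (fE ε) e * e - e‖ ≤ 2 * ε := by
  have hf := continuous_fE ε
  have : cfc (fE ε) e * e - e = cfc (fun t ↦ fE ε t * t - t) e := by
    rw [cfc_sub (fun t ↦ fE ε t * t) (fun t ↦ t) e, cfc_mul (fE ε) (fun t ↦ t) e, cfc_id' ℝ e]
  rw [this]
  refine norm_cfc_le (by positivity) fun t ht ↦ ?_
  have ht0 : 0 ≤ t := spectrum_nonneg_of_nonneg he ht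
  rcases le_total (2 * ε) t with h | h
  · simp [fE_eq_one hε h, hε.le]
  · rw [Real.norm_eq_abs, abs_le]
    constructor <;> nlinarith [fE_nonneg ε t, fE_le_one ε t]

lemma norm_mul_one_sub_cfc_fE_le {ε : ℝ} (hε : 0 < ε) {e : A} (he : 0 ≤ e) :
    ‖e * (1 - cfc (fE ε) e)‖ ≤ 2 * ε := by
  have h := norm_cfc_fE_mul_self_sub_le hε he
  have : e * (1 - cfc (fE ε) e) = -star (cfc (fE ε) e * e - e) := by
    rw [star_sub, star_mul, (IsSelfAdjoint.of_nonneg he).star_eq,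
      (IsSelfAdjoint.of_nonneg (cfc_fE_nonneg ε e)).star_eq]
    noncomm_ring
  rwa [this, norm_neg, norm_star]

lemma le_norm_smul_cfc_fE_add {ε : ℝ} (hε : 0 < ε) {e : A} (he : 0 ≤ e) :
    e ≤ ‖e‖ • cfc (fE ε) e + algebraMap ℝ A (2 * ε) := by
  cases subsingleton_or_nontrivial A
  · exact (Subsingleton.elim _ _).le
  have hf := continuous_fE ε
  have hsa := IsSelfAdjoint.of_nonneg he
  have h : ‖e‖ • cfc (fE ε) e + algebraMap ℝ A (2 * ε) =
      cfc (fun t ↦ ‖e‖ * fE ε t + 2 * ε) e := by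
    rw [cfc_add_const _ (fun t ↦ ‖e‖ * fE ε t) e, cfc_const_mul _ _ e]
  rw [h]
  conv_lhs => rw [← cfc_id' ℝ e]
  refine cfc_mono fun t ht ↦ ?_
  have hte : t ≤ ‖e‖ := (le_abs_self t).trans (spectrum.norm_le_norm_of_mem ht)
  rcases le_total (2 * ε) t with h | h
  · rw [fE_eq_one hε h]; linarith
  · have := mul_nonneg (norm_nonneg e) (fE_nonneg ε t)
    linarith

/-- The elements `f_{1/n}(e)` form a left approximate unit for `Her(e)`. -/
lemma tendsto_cfc_fE_mul {e : A} (he : 0 ≤ e) {x : A} (hx : x ∈ her e) :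
    Filter.Tendsto (fun n : ℕ ↦ cfc (fE (1 / (n + 1 : ℝ))) e * x) Filter.atTop (nhds x) := by
  rw [Metric.tendsto_atTop]
  intro δ hδ
  obtain ⟨_, ⟨z, rfl⟩, hz⟩ := Metric.mem_closure_iff.mp hx (δ / 3) (by positivity)
  have hlim : Filter.Tendsto (fun n : ℕ ↦ 2 * (1 / (n + 1 : ℝ)) * ‖z * e‖)
      Filter.atTop (nhds 0) := by
    simpa using (tendsto_one_div_add_atTop_nhds_zero_nat (𝕜 := ℝ)).const_mul 2 |>.mul_const ‖z * e‖
  obtain ⟨N, hN⟩ := (hlim.eventually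
    (gt_mem_nhds (show (0 : ℝ) < δ / 3 by positivity))).exists_forall_of_atTop
  refine ⟨N, fun n hn ↦ ?_⟩
  set f := cfc (fE (1 / (n + 1 : ℝ))) e
  rw [dist_eq_norm] at hz ⊢
  have h1 : ‖f * (x - e * z * e)‖ ≤ ‖x - e * z * e‖ :=
    (norm_mul_le _ _).trans (mul_le_of_le_one_left (norm_nonneg _) (norm_cfc_fE_le _ e))
  have h2 : ‖(f * e - e) * (z * e)‖ ≤ 2 * (1 / (n + 1 : ℝ)) * ‖z * e‖ :=
    (norm_mul_le _ _).trans
      (mul_le_mul_of_nonneg_right (norm_cfc_fE_mul_self_sub_le (by positivity) he)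
        (norm_nonneg _))
  calc ‖f * x - x‖ = ‖f * (x - e * z * e) + (f * e - e) * (z * e) - (x - e * z * e)‖ := by
        congr 1; noncomm_ring
    _ ≤ ‖f * (x - e * z * e)‖ + ‖(f * e - e) * (z * e)‖ + ‖x - e * z * e‖ :=
        (norm_sub_le _ _).trans (by gcongr; exact norm_add_le _ _)
    _ < δ := by linarith [hN n hn]

/-- For `x` in the unit ball of `Her(e)`, the mass of `e` off `x` is controlled by
`d_τ(e) - τ(x)`. -/
lemma re_mul_one_sub_le {τ : A →L[ℂ] ℂ} (h : IsTracialContraction τ) {e x : A} (he : 0 ≤ e)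
    (hx : x ∈ her e) (hx0 : 0 ≤ x) (hx1 : x ≤ 1) :
    (τ (e * (1 - x))).re ≤ ‖e‖ * (dTau τ e - (τ x).re) := by
  have hx1' : 0 ≤ 1 - x := sub_nonneg.mpr hx1
  have hlim : Filter.Tendsto (fun n : ℕ ↦
      ‖e‖ * (dTau τ e - (τ (cfc (fE (1 / (n + 1 : ℝ))) e * x)).re) + 2 * (1 / (n + 1 : ℝ)))
      Filter.atTop (nhds (‖e‖ * (dTau τ e - (τ x).re) + 2 * 0)) :=
    ((tendsto_const_nhds.sub ((Complex.continuous_re.tendsto _).comp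
      ((τ.continuous.tendsto _).comp (tendsto_cfc_fE_mul he hx)))).const_mul _).add
      ((tendsto_one_div_add_atTop_nhds_zero_nat (𝕜 := ℝ)).const_mul 2)
  rw [mul_zero, add_zero] at hlim
  refine ge_of_tendsto' hlim fun n ↦ ?_
  have hn : (0 : ℝ) < 1 / (n + 1 : ℝ) := by positivity
  have h1 := h.re_mul_le_mul_right (le_norm_smul_cfc_fE_add hn he) hx1'
  have h2 : (τ (algebraMap ℝ A (2 * (1 / (n + 1 : ℝ))) * (1 - x))).re ≤ 2 * (1 / (n + 1 : ℝ)) := by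
    refine (h.re_mul_le_mul_left (sub_le_self 1 hx0) (algebraMap_nonneg A (by positivity))).trans ?_
    rw [mul_one]
    exact h.re_algebraMap_le (by positivity)
  have h3 := re_cfc_fE_le_dTau h e n
  rw [add_mul, map_add, Complex.add_re, smul_mul_assoc,
    mul_one_sub (cfc _ e)] at h1
  have h4 : (τ (‖e‖ • (cfc (fE (1 / (n + 1 : ℝ))) e - cfc (fE (1 / (n + 1 : ℝ))) e * x))).re =
      ‖e‖ * ((τ (cfc (fE (1 / (n + 1 : ℝ))) e)).re -
        (τ (cfc (fE (1 / (n + 1 : ℝ))) e * x)).re) := by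
    rw [τ.map_smul_of_tower, Complex.smul_re, map_sub, Complex.sub_re, smul_eq_mul]
  rw [h4] at h1
  have := mul_le_mul_of_nonneg_left (sub_le_sub_right h3
    (τ (cfc (fE (1 / (n + 1 : ℝ))) e * x)).re) (norm_nonneg e)
  linarith

end StarOrdered

lemma sum_mul_sum_of_orthogonal {ι R : Type*} [NonUnitalNonAssocSemiring R]
    (s : Finset ι) {x y : ι → R} (h : ∀ i j, i ≠ j → x i * y j = 0) :
    (∑ i ∈ s, x i) * ∑ i ∈ s, y i = ∑ i ∈ s, x i * y i := by
  rw [Finset.sum_mul_sum]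
  refine Finset.sum_congr rfl fun i hi ↦ ?_
  exact Finset.sum_eq_single_of_mem i hi fun j _ hj ↦ h i j hj.symm

lemma IsTracialContraction.re_star_mul_self_add_le {τ : A →L[ℂ] ℂ} (h : IsTracialContraction τ)
    (u v w : A) : (τ (star (u + v + w) * (u + v + w))).re ≤
      3 * ((τ (star u * u)).re + (τ (star v * v)).re + (τ (star w * w)).re) := by
  have h1 := h.re_star_mul_self_nonneg (u - v)
  have h2 := h.re_star_mul_self_nonneg (v - w)
  have h3 := h.re_star_mul_self_nonneg (u - w)
  simp only [star_add, star_sub, mul_add, add_mul, mul_sub, sub_mul, map_add, map_sub,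
    Complex.add_re, Complex.sub_re] at h1 h2 h3 ⊢
  linarith

section StarOrdered

variable [PartialOrder A] [StarOrderedRing A]

lemma sum_le_one_of_orthogonal {ι : Type*} (s : Finset ι) {x : ι → A}
    (h1 : ∀ i, x i ≤ 1) (h : ∀ i j, i ≠ j → x i * x j = 0) : ∑ i ∈ s, x i ≤ 1 := by
  classical
  induction s using Finset.induction_on with
  | empty => simp
  | insert i s hi ih =>
    have h2 : x i * ∑ j ∈ s, x j = 0 := by
      rw [Finset.mul_sum]
      exact Finset.sum_eq_zero fun j hj ↦ h i j (ne_of_mem_of_not_mem hj hi).symm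
    have h3 : (∑ j ∈ s, x j) * x i = 0 := by
      rw [Finset.sum_mul]
      exact Finset.sum_eq_zero fun j hj ↦ h j i (ne_of_mem_of_not_mem hj hi)
    have h4 : 0 ≤ (1 - x i) * (1 - ∑ j ∈ s, x j) := by
      refine Commute.mul_nonneg (sub_nonneg.mpr (h1 i)) (sub_nonneg.mpr ih) ?_
      rw [commute_iff_eq]
      simp only [mul_sub, sub_mul, h2, h3, one_mul, mul_one, sub_zero]
      abel
    rw [Finset.sum_insert hi, ← sub_nonneg]
    convert h4 using 1
    simp only [mul_sub, sub_mul, h2, one_mul, mul_one, sub_zero]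
    abel

lemma mul_self_le_one {s : A} (hs : 0 ≤ s) (hs1 : s ≤ 1) : s * s ≤ 1 := by
  have h : 0 ≤ (1 - s) * (1 + s) := by
    refine Commute.mul_nonneg (sub_nonneg.mpr hs1) (add_nonneg zero_le_one hs) ?_
    rw [commute_iff_eq]
    noncomm_ring
  rw [← sub_nonneg]
  convert h using 1
  noncomm_ring

lemma mul_self_le_norm_smul {e : A} (he : 0 ≤ e) : e * e ≤ ‖e‖ • e := by
  have h : 0 ≤ e * (algebraMap ℝ A ‖e‖ - e) :=
    Commute.mul_nonneg he (sub_nonneg.mpr (IsSelfAdjoint.of_nonneg he).le_algebraMap_norm_self)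
      (Commute.sub_right (Algebra.commutes ‖e‖ e).symm (.refl e))
  rwa [mul_sub, ← Algebra.commutes, ← Algebra.smul_def, sub_nonneg] at h

lemma IsTracialContraction.re_star_sub_conj_le {τ : A →L[ℂ] ℂ} (h : IsTracialContraction τ)
    {e s : A} (he : 0 ≤ e) (hs : 0 ≤ s) (hs1 : s ≤ 1) (y : A) :
    (τ (star (e - s * y * s) * (e - s * y * s))).re ≤
      3 * (2 * (‖e‖ * (τ (e * (1 - s * s))).re) + ‖e - y‖ ^ 2) := by
  have hes := (IsSelfAdjoint.of_nonneg he).star_eq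
  have hss := (IsSelfAdjoint.of_nonneg hs).star_eq
  have hsn : ‖s‖ ≤ 1 := (CStarAlgebra.norm_le_one_iff_of_nonneg s hs).mpr hs1
  have hsq : 0 ≤ 1 - s * s := sub_nonneg.mpr (mul_self_le_one hs hs1)
  have hsub : (1 - s) * (1 - s) ≤ 1 - s * s := by
    have : 0 ≤ s * (1 - s) + s * (1 - s) := by
      have := Commute.mul_nonneg hs (sub_nonneg.mpr hs1)
        ((Commute.one_right s).sub_right (.refl s))
      exact add_nonneg this this
    rw [← sub_nonneg]
    convert this using 1
    noncomm_ring
  have hee : 0 ≤ e * e := by simpa [hes] using star_mul_self_nonneg e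
  have hu : (τ (star ((1 - s) * e) * ((1 - s) * e))).re ≤ ‖e‖ * (τ (e * (1 - s * s))).re := by
    have h1 : star ((1 - s) * e) * ((1 - s) * e) = e * ((1 - s) * (1 - s) * e) := by
      simp only [star_mul, star_sub, star_one, hes, hss, mul_assoc]
    have h2 : (τ (‖e‖ • e * (1 - s * s))).re = ‖e‖ * (τ (e * (1 - s * s))).re := by
      rw [smul_mul_assoc, τ.map_smul_of_tower, Complex.smul_re, smul_eq_mul]
    rw [h1, h.2.2, mul_assoc, h.2.2, ← h2]
    exact (h.re_mul_le_mul_left hsub hee).trans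
      (h.re_mul_le_mul_right (mul_self_le_norm_smul he) hsq)
  have hv : (τ (star (s * e * (1 - s)) * (s * e * (1 - s)))).re ≤
      (τ (star ((1 - s) * e) * ((1 - s) * e))).re := by
    have h1 : star (s * e * (1 - s)) * (s * e * (1 - s)) =
        ((1 - s) * e) * (s * s * (e * (1 - s))) := by
      simp only [star_mul, star_sub, star_one, hes, hss, mul_assoc]
    have h2 : star ((1 - s) * e) * ((1 - s) * e) = e * (1 - s) * ((1 - s) * e) := by
      simp only [star_mul, star_sub, star_one, hes, hss]
    have h3 : 0 ≤ e * (1 - s) * ((1 - s) * e) := h2 ▸ star_mul_self_nonneg _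
    rw [h1, h.2.2, h2, mul_assoc (s * s)]
    simpa using h.re_mul_le_mul_right (mul_self_le_one hs hs1) h3
  have hw : (τ (star (s * (e - y) * s) * (s * (e - y) * s))).re ≤ ‖e - y‖ ^ 2 := by
    refine (h.re_le_norm _).trans ?_
    rw [CStarRing.norm_star_mul_self, ← sq]
    gcongr
    calc ‖s * (e - y) * s‖ ≤ ‖s‖ * ‖e - y‖ * ‖s‖ := norm_mul₃_le
      _ ≤ 1 * ‖e - y‖ * 1 := by gcongr
      _ = ‖e - y‖ := by ring
  have hsum : e - s * y * s = (1 - s) * e + s * e * (1 - s) + s * (e - y) * s := by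
    noncomm_ring
  rw [hsum]
  linarith [h.re_star_mul_self_add_le ((1 - s) * e) (s * e * (1 - s)) (s * (e - y) * s)]

/-- The oscillation of `s y s` is controlled by any `E` acting as a unit on `s`, provided `y` is
bounded below by a positive scalar. -/
lemma osc_conj_le {s y E : A} {κ r : ℝ} (hκ : 0 < κ) (hs : 0 ≤ s) (hs1 : s ≤ 1)
    (hy : algebraMap ℝ A κ ≤ y) (hE : 0 ≤ E) (hEs : E * s = s) (hr : 0 ≤ r)
    (h : ∀ τ : A →L[ℂ] ℂ, IsTracialState τ → (τ E).re - (τ (s * s)).re ≤ r) :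
    osc (s * y * s) ≤ r := by
  set c := s * y * s with hc
  have hκc : κ • (s * s) ≤ c := by
    have := conjugate_le_conjugate_of_nonneg hy hs
    rwa [← Algebra.commutes, ← Algebra.smul_def, smul_mul_assoc] at this
  have hss0 : 0 ≤ s * s := by
    simpa [(IsSelfAdjoint.of_nonneg hs).star_eq] using star_mul_self_nonneg s
  have hc0 : 0 ≤ c := (smul_nonneg hκ.le hss0).trans hκc
  have hEc : E * c = c := by rw [hc, ← mul_assoc, ← mul_assoc, hEs]
  have hbound (n : ℕ) : osc c ≤ r + 2 / κ * (1 / (n + 1 : ℝ)) := by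
    refine osc_le_of_forall n (by positivity) fun τ hτ ↦ ?_
    have hτ' := hτ.isTracialContraction
    have hn : (0 : ℝ) < 1 / (n + 1 : ℝ) := by positivity
    have hd : dTau τ c ≤ (τ E).re := by
      refine ciSup_le fun j ↦ ?_
      have hj : (0 : ℝ) < 1 / (j + 1 : ℝ) := by positivity
      obtain ⟨z, hz⟩ := exists_cfc_eq_mul_mul hj (continuous_fE (1 / (j + 1 : ℝ)))
        (fun t ht ↦ fE_eq_zero hj ht) (IsSelfAdjoint.of_nonneg hc0)
      have hEf : E * cfc (fE (1 / (j + 1 : ℝ))) c = cfc (fE (1 / (j + 1 : ℝ))) c := by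
        rw [hz, mul_assoc, ← mul_assoc, hEc]
      have := hτ'.re_mul_le_mul_left (cfc_fE_le_one (1 / (j + 1 : ℝ)) c) hE
      rwa [hEf, mul_one] at this
    set f := cfc (fE (1 / (n + 1 : ℝ))) c with hf
    have hf0 : 0 ≤ f := cfc_fE_nonneg _ c
    have hf1 : 0 ≤ 1 - f := sub_nonneg.mpr (cfc_fE_le_one _ c)
    have h1 : κ * (τ (s * s * (1 - f))).re ≤ 2 * (1 / (n + 1 : ℝ)) := by
      have h2 := hτ'.re_mul_le_mul_right hκc hf1
      rw [smul_mul_assoc, τ.map_smul_of_tower, Complex.smul_re, smul_eq_mul] at h2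
      exact h2.trans ((hτ'.re_le_norm _).trans (norm_mul_one_sub_cfc_fE_le hn hc0))
    have h3 : (τ (s * s * (1 - f))).re ≤ 2 / κ * (1 / (n + 1 : ℝ)) := by
      rw [div_mul_eq_mul_div, le_div_iff₀ hκ, mul_comm]
      exact h1
    have h4 : (τ (s * s * f)).re ≤ (τ f).re := by
      simpa using hτ'.re_mul_le_mul_right (mul_self_le_one hs hs1) hf0
    rw [mul_one_sub, map_sub, Complex.sub_re] at h3
    linarith [h τ hτ]
  have hlim : Filter.Tendsto (fun n : ℕ ↦ r + 2 / κ * (1 / (n + 1 : ℝ))) Filter.atTop (nhds r) := by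
    simpa using ((tendsto_one_div_add_atTop_nhds_zero_nat (𝕜 := ℝ)).const_mul (2 / κ)).const_add r
  exact ge_of_tendsto' hlim hbound

/-- A positive square root `g` of `f_{1/n}(b)`, together with a local unit for it. -/
lemma exists_sqrt_cfc_fE {b : A} (hb : 0 ≤ b) (k : ℕ) :
    ∃ g : A, 0 ≤ g ∧ g ≤ 1 ∧ g * g = cfc (fE (1 / (k + 1 : ℝ))) b ∧
      (∃ z, g = b * z * b) ∧ ∃ m : ℕ, cfc (fE (1 / (m + 1 : ℝ))) b * g = g ∧
        ∃ z, cfc (fE (1 / (m + 1 : ℝ))) b = b * z * b := by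
  have hk : (0 : ℝ) < 1 / (k + 1 : ℝ) := by positivity
  have hsa := IsSelfAdjoint.of_nonneg hb
  have hf := continuous_fE (1 / (k + 1 : ℝ))
  have hg : Continuous fun t ↦ √(fE (1 / (k + 1 : ℝ)) t) := hf.sqrt
  have hm : ((2 * k + 1 : ℕ) + 1 : ℝ) = 2 * (k + 1) := by push_cast; ring
  have hm0 : (0 : ℝ) < 1 / (2 * (k + 1) : ℝ) := by positivity
  refine ⟨cfc (fun t ↦ √(fE (1 / (k + 1 : ℝ)) t)) b, cfc_nonneg fun t _ ↦ Real.sqrt_nonneg _,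
    cfc_le_one _ _ fun t _ ↦ Real.sqrt_le_one.mpr (fE_le_one _ t), ?_,
    exists_cfc_eq_mul_mul hk hg (fun t ht ↦ by rw [fE_eq_zero hk ht, Real.sqrt_zero]) hsa,
    2 * k + 1, ?_, ?_⟩
  · rw [← cfc_mul _ _ b hg.continuousOn hg.continuousOn]
    exact cfc_congr fun t _ ↦ Real.mul_self_sqrt (fE_nonneg _ t)
  · rw [hm, ← cfc_mul _ _ b (continuous_fE _).continuousOn hg.continuousOn]
    refine cfc_congr fun t _ ↦ ?_
    rcases le_total t (1 / (k + 1 : ℝ)) with ht | ht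
    · rw [fE_eq_zero hk ht, Real.sqrt_zero, mul_zero]
    · have h2 : 2 * (1 / (2 * (k + 1) : ℝ)) ≤ t := by
        refine le_of_eq_of_le ?_ ht
        field_simp
      rw [fE_eq_one hm0 h2, one_mul]
  · rw [hm]
    exact exists_cfc_eq_mul_mul hm0 (continuous_fE _) (fun t ht ↦ fE_eq_zero hm0 ht) hsa

end StarOrdered

lemma taoZero_zero [PartialOrder A] [StarOrderedRing A] : TAOZero (0 : A) := by
  intro ε hε
  refine ⟨0, zero_mem_her 0, le_rfl, le_rfl, ?_, ?_⟩
  · simpa [norm2] using hε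
  · have hcfc (n : ℕ) : cfc (fE (1 / (n + 1 : ℝ))) (0 : A) = 0 := by
      have hn : (0 : ℝ) < 1 / (n + 1 : ℝ) := by positivity
      rw [cfc_apply_zero, fE_eq_zero hn hn.le, map_zero]
    refine lt_of_le_of_lt (osc_le_of_forall 0 le_rfl fun τ _ ↦ ?_) hε
    simp only [dTau, hcfc, map_zero, Complex.zero_re, ciSup_const, sub_zero, le_refl]

/-- An almost exhausting orthogonal decomposition of `e` yields a positive contraction `s` in
`Her(e)` with `τ(e(1 - s²))` uniformly small, and a unit `E` for `s` with `τ(E) - τ(s²)`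
uniformly small. -/
lemma exists_uniform_exhaustion [PartialOrder A] [StarOrderedRing A] {e : A} (he : 0 ≤ e)
    (he0 : e ≠ 0) {δ : ℝ} (hδ : 0 < δ) {b : ℕ → A} (hbe : ∀ n, b n ∈ her e)
    (hb : ∀ n, 0 ≤ b n) (horth : ∀ n m, n ≠ m → b n * b m = 0)
    (hosc : Summable fun n ↦ osc (b n)) (hoscδ : ∑' n, osc (b n) < δ)
    (hd : ∀ τ : A →L[ℂ] ℂ, IsTracialState τ →
      (Summable fun n ↦ dTau τ (b n)) ∧ dTau τ e - (∑' n, dTau τ (b n)) < δ) :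
    ∃ s E : A, s ∈ her e ∧ 0 ≤ s ∧ s ≤ 1 ∧ 0 ≤ E ∧ E * s = s ∧
      ∀ τ : A →L[ℂ] ℂ, IsTracialState τ →
        (τ E).re - (τ (s * s)).re ≤ 2 * δ ∧ (τ (e * (1 - s * s))).re < 3 * δ * ‖e‖ := by
  have hepos : 0 < ‖e‖ := norm_pos_iff.mpr he0
  have hk (n : ℕ) : ∃ k : ℕ, ∀ τ : A →L[ℂ] ℂ, IsTracialState τ →
      dTau τ (b n) - (τ (cfc (fE (1 / (k + 1 : ℝ))) (b n))).re < osc (b n) + δ / 2 / 2 ^ n :=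
    exists_dTau_sub_lt (lt_add_of_pos_right _ (by positivity))
  choose k hk using hk
  choose g hg0 hg1 hgg hgz m hFg hFz using fun n ↦ exists_sqrt_cfc_fE (hb n) (k n)
  have horth' (x y : A) (i j : ℕ) (hij : i ≠ j) : b i * x * b i * (b j * y * b j) = 0 := by
    rw [mul_assoc (b j), mul_assoc (b i * x), ← mul_assoc (b i) (b j), horth i j hij, zero_mul,
      mul_zero]
  have hgo (i j : ℕ) (hij : i ≠ j) : g i * g j = 0 := by
    obtain ⟨x, hx⟩ := hgz i
    obtain ⟨y, hy⟩ := hgz j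
    rw [hx, hy, horth' x y i j hij]
  have hFo (i j : ℕ) (hij : i ≠ j) : cfc (fE (1 / (m i + 1 : ℝ))) (b i) * g j = 0 := by
    obtain ⟨x, hx⟩ := hFz i
    obtain ⟨y, hy⟩ := hgz j
    rw [hx, hy, horth' x y i j hij]
  let s (N : ℕ) : A := ∑ i ∈ Finset.range N, g i
  have hs0 (N : ℕ) : 0 ≤ s N := Finset.sum_nonneg fun i _ ↦ hg0 i
  have hs1 (N : ℕ) : s N ≤ 1 := sum_le_one_of_orthogonal _ hg1 hgo
  have hse (N : ℕ) : s N ∈ her e := sum_mem_her _ fun i _ ↦ by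
    obtain ⟨x, hx⟩ := hgz i
    rw [hx]
    exact mul_mul_mem_her (hbe i) (hbe i) x
  have hss (N : ℕ) : s N * s N = ∑ i ∈ Finset.range N, cfc (fE (1 / (k i + 1 : ℝ))) (b i) := by
    rw [sum_mul_sum_of_orthogonal _ hgo]
    exact Finset.sum_congr rfl fun i _ ↦ hgg i
  have hsse (N : ℕ) : s N * s N ∈ her e := by
    rw [hss]
    refine sum_mem_her _ fun i _ ↦ ?_
    have hi : (0 : ℝ) < 1 / (k i + 1 : ℝ) := by positivity
    obtain ⟨x, hx⟩ := exists_cfc_eq_mul_mul hi (continuous_fE _)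
      (fun t ht ↦ fE_eq_zero hi ht) (IsSelfAdjoint.of_nonneg (hb i))
    rw [hx]
    exact mul_mul_mem_her (hbe i) (hbe i) x
  have hss0 (N : ℕ) : 0 ≤ s N * s N := by
    rw [hss]; exact Finset.sum_nonneg fun i _ ↦ cfc_fE_nonneg _ _
  have hgeom : HasSum (fun n : ℕ ↦ δ / 2 / 2 ^ n) δ := hasSum_geometric_two' δ
  have hρ : Summable fun n ↦ osc (b n) + δ / 2 / 2 ^ n := hosc.add hgeom.summable
  have hρsum : ∑' n, (osc (b n) + δ / 2 / 2 ^ n) < 2 * δ := by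
    rw [hosc.tsum_add hgeom.summable, hgeom.tsum_eq]
    linarith
  have hre (τ : A →L[ℂ] ℂ) (N : ℕ) : (τ (s N * s N)).re =
      ∑ i ∈ Finset.range N, (τ (cfc (fE (1 / (k i + 1 : ℝ))) (b i))).re := by
    rw [hss, map_sum, Complex.re_sum]
  obtain ⟨N, hN⟩ := exists_forall_re_lt (y := fun N ↦ e * (1 - s N * s N))
    (r := 3 * δ * ‖e‖) (by positivity)
    (fun τ hτ ↦ antitone_nat_of_succ_le fun n ↦ hτ.re_mul_le_mul_left (by
      rw [hss, hss, Finset.sum_range_succ]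
      exact sub_le_sub_left (le_add_of_nonneg_right (cfc_fE_nonneg _ _)) 1) he)
    (fun τ hτ ↦ by
      have hτ' := hτ.isTracialContraction
      obtain ⟨hsum, hlt⟩ := hd τ hτ
      have hτsum : Summable fun i ↦ (τ (cfc (fE (1 / (k i + 1 : ℝ))) (b i))).re :=
        hsum.of_nonneg_of_le (fun i ↦ hτ'.re_nonneg (cfc_fE_nonneg _ _))
          fun i ↦ re_cfc_fE_le_dTau hτ' _ _
      have hle : ∑' i, dTau τ (b i) - ∑' i, (τ (cfc (fE (1 / (k i + 1 : ℝ))) (b i))).re ≤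
          ∑' n, (osc (b n) + δ / 2 / 2 ^ n) := by
        rw [← hsum.tsum_sub hτsum]
        exact (hsum.sub hτsum).tsum_le_tsum (fun i ↦ (hk i τ hτ).le) hρ
      obtain ⟨N, hN⟩ := (hτsum.hasSum.tendsto_sum_nat.eventually
        (lt_mem_nhds (show dTau τ e - 3 * δ < _ by linarith))).exists
      refine ⟨N, (re_mul_one_sub_le hτ' he (hsse N) (hss0 N)
        (mul_self_le_one (hs0 N) (hs1 N))).trans_lt ?_⟩
      rw [hre, mul_comm (3 * δ)]
      exact mul_lt_mul_of_pos_left (by linarith) hepos)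
  refine ⟨s N, ∑ i ∈ Finset.range N, cfc (fE (1 / (m i + 1 : ℝ))) (b i), hse N, hs0 N, hs1 N,
    Finset.sum_nonneg fun i _ ↦ cfc_fE_nonneg _ _, ?_, fun τ hτ ↦ ⟨?_, hN τ hτ⟩⟩
  · rw [sum_mul_sum_of_orthogonal _ hFo]
    exact Finset.sum_congr rfl fun i _ ↦ hFg i
  · rw [hre, map_sum, Complex.re_sum, ← Finset.sum_sub_distrib]
    refine (Finset.sum_le_sum fun i _ ↦ ?_).trans
      ((hρ.sum_le_tsum (Finset.range N) fun i _ ↦ ?_).trans hρsum.le)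
    · exact (sub_le_sub_right (re_cfc_fE_le_dTau hτ.isTracialContraction (b i) (m i)) _).trans
        (hk i τ hτ).le
    · exact add_nonneg (osc_nonneg _) (by positivity)

/-- A bounded perturbation of a positive element that is bounded below by a scalar. -/
lemma exists_algebraMap_le_norm_sub_le [PartialOrder A] [StarOrderedRing A] {e : A} (he : 0 ≤ e)
    {η : ℝ} (hη0 : 0 ≤ η) (hη1 : η ≤ 1) :
    ∃ y : A, algebraMap ℝ A (η * ‖e‖) ≤ y ∧ ‖y‖ ≤ ‖e‖ ∧ ‖e - y‖ ≤ 2 * η * ‖e‖ := by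
  have hη : 0 ≤ η * ‖e‖ := by positivity
  have hnorm : ‖algebraMap ℝ A (η * ‖e‖)‖ ≤ η * ‖e‖ := by
    cases subsingleton_or_nontrivial A
    · simpa [Subsingleton.elim (algebraMap ℝ A (η * ‖e‖)) 0] using hη
    · rw [norm_algebraMap', Real.norm_of_nonneg hη]
  refine ⟨(1 - η) • e + algebraMap ℝ A (η * ‖e‖),
    le_add_of_nonneg_left (smul_nonneg (sub_nonneg.mpr hη1) he), ?_, ?_⟩
  · calc _ ≤ ‖(1 - η) • e‖ + ‖algebraMap ℝ A (η * ‖e‖)‖ := norm_add_le _ _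
      _ ≤ (1 - η) * ‖e‖ + η * ‖e‖ := by
        rw [norm_smul, Real.norm_of_nonneg (sub_nonneg.mpr hη1)]
        gcongr
      _ = ‖e‖ := by ring
  · calc _ = ‖η • e - algebraMap ℝ A (η * ‖e‖)‖ := by
          congr 1; rw [sub_smul, one_smul]; abel
      _ ≤ ‖η • e‖ + ‖algebraMap ℝ A (η * ‖e‖)‖ := norm_sub_le _ _
      _ ≤ η * ‖e‖ + η * ‖e‖ := by
        rw [norm_smul, Real.norm_of_nonneg hη0]
        gcongr
      _ = 2 * η * ‖e‖ := by ring

/-- Lemma 3.12: if for every `ε > 0` there is a sequence of mutually orthogonal positive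
contractions `(b_n)` in `Her(e)` with `∑ ω(b_n) < ε` and `d_τ(e) − ∑ d_τ(b_n) < ε` for all
tracial states `τ`, then `e` has tracial approximate oscillation zero. -/
theorem taoZero_of_decomposition [IsSimpleRing A] [PartialOrder A] [StarOrderedRing A]
    (hT : (traceSet A).Nonempty) (e : A) (he : 0 ≤ e)
    (H : ∀ ε : ℝ, 0 < ε → ∃ b : ℕ → A,
      (∀ n, b n ∈ her e) ∧ (∀ n, 0 ≤ b n) ∧ (∀ n, ‖b n‖ ≤ 1) ∧
      (∀ n m, n ≠ m → b n * b m = 0) ∧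
      (Summable fun n => osc (b n)) ∧ (∑' n, osc (b n)) < ε ∧
      ∀ τ : A →L[ℂ] ℂ, IsTracialState τ →
        (Summable fun n => dTau τ (b n)) ∧ dTau τ e - (∑' n, dTau τ (b n)) < ε) :
    TAOZero e := by
  rcases eq_or_ne e 0 with rfl | he0
  · exact taoZero_zero
  intro ε hε
  have hM : 0 < ‖e‖ := norm_pos_iff.mpr he0
  set M := ‖e‖
  obtain ⟨δ, hδ0, hδ1, hδ2⟩ : ∃ δ : ℝ, 0 < δ ∧ 2 * δ < ε ∧ 18 * M ^ 2 * δ ≤ ε ^ 2 / 4 := by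
    refine ⟨min (ε / 4) (ε ^ 2 / (72 * M ^ 2)), by positivity, ?_, ?_⟩
    · linarith [min_le_left (ε / 4) (ε ^ 2 / (72 * M ^ 2))]
    · calc _ ≤ 18 * M ^ 2 * (ε ^ 2 / (72 * M ^ 2)) := by gcongr; exact min_le_right _ _
        _ = ε ^ 2 / 4 := by field_simp; norm_num
  obtain ⟨η, hη0, hη1, hη2⟩ : ∃ η : ℝ, 0 < η ∧ η ≤ 1 ∧ 2 * η * M ≤ ε / 4 := by
    refine ⟨min 1 (ε / (8 * M)), by positivity, min_le_left _ _, ?_⟩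
    calc _ ≤ 2 * (ε / (8 * M)) * M := by gcongr; exact min_le_right _ _
      _ = ε / 4 := by field_simp; norm_num
  obtain ⟨b, hbe, hb, -, horth, hosc, hoscδ, hd⟩ := H δ hδ0
  obtain ⟨s, E, hse, hs0, hs1, hE, hEs, hτ⟩ :=
    exists_uniform_exhaustion he he0 hδ0 hbe hb horth hosc hoscδ hd
  obtain ⟨y, hy, hyn, hey⟩ := exists_algebraMap_le_norm_sub_le he hη0.le hη1
  have hκ : 0 < η * M := by positivity
  have hy0 : 0 ≤ y := (algebraMap_nonneg A hκ.le).trans hy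
  have hsn : ‖s‖ ≤ 1 := (CStarAlgebra.norm_le_one_iff_of_nonneg s hs0).mpr hs1
  refine ⟨s * y * s, mul_mul_mem_her hse hse y, conjugate_nonneg_of_nonneg hy0 hs0, ?_, ?_,
    (osc_conj_le hκ hs0 hs1 hy hE hEs (by positivity) fun τ h ↦ (hτ τ h).1).trans_lt hδ1⟩
  · calc ‖s * y * s‖ ≤ ‖s‖ * ‖y‖ * ‖s‖ := norm_mul₃_le
      _ ≤ 1 * M * 1 := by gcongr
      _ = M := by ring
  · refine (Real.iSup_le (a := 3 / 4 * ε) (fun τ ↦ ?_) (by positivity)).trans_lt (by linarith)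
    refine Real.sqrt_le_iff.mpr ⟨by positivity, ?_⟩
    have h1 := (IsTracialState.isTracialContraction τ.2).re_star_sub_conj_le he hs0 hs1 y
    have h2 := mul_le_mul_of_nonneg_left (hτ τ.1 τ.2).2.le hM.le
    have h3 : ‖e - y‖ ^ 2 ≤ (ε / 4) ^ 2 := by gcongr; exact hey.trans hη2
    nlinarith
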